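/- Let ℓ = 2d+1 be odd and let x ∈ {0,1}^(2^ℓ) be A-winnable (i.e., NAND_ℓ(x) = 1), with consecutive halves x^0, x^1. Then C_A(x) = (1/2)(C_A(x^0) + C_A(x^1)), and in particular both C_A(x^0) and C_A(x^1) are finite. -/

import Mathlib

open scoped ENNReal
open scoped Classical

namespace NandTree

/-- The bit-`b` half of an input of length `2^(m+1)`: `b = false` gives the first half,
`b = true` the second half (lexicographic indexing, first bit most significant). -/
def halfInput (m : ℕ) (b : Bool) (x : Fin (2^(m+1)) → Bool) : Fin (2^m) → Bool :=
  fun i => x ⟨(cond b 1 0) * 2^m + i.val, by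
    have h := i.isLt
    have h2 : (2:ℕ)^(m+1) = 2^m * 2 := pow_succ 2 m
    cases b <;> simp only [cond_true, cond_false] <;> omega⟩

/-- The value `NAND_ℓ(x)` of a depth-`ℓ` NAND-tree instance: internal nodes at even
distance from the leaves are OR gates, at odd distance AND gates. -/
def nand : (ℓ : ℕ) → (Fin (2^ℓ) → Bool) → Bool
  | 0, x => x ⟨0, by norm_num⟩
  | (ℓ+1), x =>
    if (ℓ+1) % 2 = 0 then
      nand ℓ (halfInput ℓ false x) || nand ℓ (halfInput ℓ true x)
    else
      nand ℓ (halfInput ℓ false x) && nand ℓ (halfInput ℓ true x)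

/-- Index of a leaf given by a root-to-leaf bit string (lexicographic, first bit most
significant). -/
def leafIdx (s : List Bool) : ℕ := s.foldl (fun n b => 2 * n + cond b 1 0) 0

/-- The value of the leaf reached by bit string `s` in instance `x`. -/
def leafVal (m : ℕ) (x : Fin (2^m) → Bool) (s : List Bool) : Bool :=
  if h : leafIdx s < 2^m then x ⟨leafIdx s, h⟩ else false

/-- The root-to-leaf path determined by strategies `σA`, `σB` (each assigning a choice of
child to every node, nodes being given by the list of choices from the root): at a node
at distance `m+1` from the leaves, Player A chooses a child if `m+1` is even, else
Player B chooses. -/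
def gamePath (σA σB : List Bool → Bool) : (m : ℕ) → List Bool → List Bool
  | 0, p => p
  | (m+1), p => gamePath σA σB m (p ++ [if (m+1) % 2 = 0 then σA p else σB p])

/-- `winning Z m x σ`: strategy `σ` is a winning strategy for player `Z` (`true` = A,
`false` = B) in the two-player game on the depth-`m` instance `x`: against every
opponent strategy, the reached leaf has value `Z` (A wins on `1 = true`, B on
`0 = false`). -/
def winning (Z : Bool) (m : ℕ) (x : Fin (2^m) → Bool) (σ : List Bool → Bool) : Prop :=
  ∀ τ : List Bool → Bool,
    leafVal m x (gamePath (if Z then σ else τ) (if Z then τ else σ) m []) = Z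

mutual

/-- The criticality `c(v)` of the root of a depth-`m` subtree with input `y`. -/
noncomputable def crit : (m : ℕ) → (Fin (2^m) → Bool) → ℝ≥0∞
  | 0, _ => 1
  | 1, y => if y ⟨0, by norm_num⟩ = y ⟨1, by norm_num⟩ then 1 else 2
  | (m+2), y =>
    if nand (m+2) y ≠ decide ((m+2) % 2 = 0) then 1
    else if nand (m+1) (halfInput (m+1) false y) ≠ nand (m+1) (halfInput (m+1) true y) then 2
    else
      (max (CZ (decide ((m+2) % 2 = 0)) m (halfInput m false (halfInput (m+1) false y)) +
            CZ (decide ((m+2) % 2 = 0)) m (halfInput m true (halfInput (m+1) false y)))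
           (CZ (decide ((m+2) % 2 = 0)) m (halfInput m false (halfInput (m+1) true y)) +
            CZ (decide ((m+2) % 2 = 0)) m (halfInput m true (halfInput (m+1) true y)))) /
      (((CZ (decide ((m+2) % 2 = 0)) m (halfInput m false (halfInput (m+1) false y)) +
         CZ (decide ((m+2) % 2 = 0)) m (halfInput m true (halfInput (m+1) false y))) +
        ((CZ (decide ((m+2) % 2 = 0)) m (halfInput m false (halfInput (m+1) true y)) +
          CZ (decide ((m+2) % 2 = 0)) m (halfInput m true (halfInput (m+1) true y))))) / 2)
termination_by m _ => (m, 0)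

/-- The expected product, over the random choices of `Z`'s opponent, of the criticalities
of the nodes at which `Z` moves along the path played according to strategy `σ`. -/
noncomputable def pathProd (Z : Bool) :
    (σ : List Bool → Bool) → (m : ℕ) → (Fin (2^m) → Bool) → ℝ≥0∞
  | _, 0, _ => 1
  | σ, (m+1), y =>
    if decide ((m+1) % 2 = 0) = Z then
      crit (m+1) y * pathProd Z (fun q => σ (σ [] :: q)) m (halfInput m (σ []) y)
    else
      (pathProd Z (fun q => σ (false :: q)) m (halfInput m false y) +
       pathProd Z (fun q => σ (true :: q)) m (halfInput m true y)) / 2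
termination_by _ m _ => (m, 1)

/-- The average choice complexity `C_Z` of a depth-`m` instance `y` for player `Z`
(`true` = A, `false` = B): the infimum, over `Z`-winning strategies, of the expected
product of criticalities over the nodes where `Z` moves (and `∞` if `Z` has no winning
strategy, the infimum over the empty set being `⊤`). -/
noncomputable def CZ (Z : Bool) (m : ℕ) (y : Fin (2^m) → Bool) : ℝ≥0∞ :=
  ⨅ σ ∈ {σ : List Bool → Bool | winning Z m y σ}, pathProd Z σ m y
termination_by (m, 2)

end

theorem leafIdx_aux (s : List Bool) (n : ℕ) :
    s.foldl (fun n b => 2 * n + cond b 1 0) n = n * 2 ^ s.length + leafIdx s := by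
  induction s generalizing n with
  | nil => simp [leafIdx]
  | cons b s ih =>
    simp only [leafIdx, List.foldl_cons, List.length_cons]
    rw [ih, ih (2 * 0 + cond b 1 0)]
    ring

theorem leafIdx_cons (b : Bool) (s : List Bool) :
    leafIdx (b :: s) = cond b 1 0 * 2 ^ s.length + leafIdx s := by
  have := leafIdx_aux s (2 * 0 + cond b 1 0)
  simpa [leafIdx] using this

theorem leafIdx_lt (s : List Bool) : leafIdx s < 2 ^ s.length := by
  induction s with
  | nil => simp [leafIdx]
  | cons b s ih =>
    rw [leafIdx_cons, List.length_cons, pow_succ]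
    cases b <;> simp only [cond_true, cond_false] <;> omega

theorem leafVal_cons (m : ℕ) (x : Fin (2^(m+1)) → Bool) (b : Bool) (s : List Bool)
    (hs : s.length = m) : leafVal (m+1) x (b :: s) = leafVal m (halfInput m b x) s := by
  have h1 : leafIdx s < 2 ^ m := hs ▸ leafIdx_lt s
  have h2 : leafIdx (b :: s) < 2 ^ (m+1) := by
    have := leafIdx_lt (b :: s)
    rwa [List.length_cons, hs] at this
  have h3 := leafIdx_cons b s
  rw [hs] at h3
  rw [leafVal, leafVal, dif_pos h1, dif_pos h2]
  simp only [halfInput, h3]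

theorem gamePath_length (σA σB : List Bool → Bool) (m : ℕ) (p : List Bool) :
    (gamePath σA σB m p).length = p.length + m := by
  induction m generalizing p with
  | zero => simp [gamePath]
  | succ m ih => rw [gamePath, ih]; simp; omega

theorem gamePath_cons (σA σB : List Bool → Bool) (m : ℕ) (b : Bool) (p : List Bool) :
    gamePath σA σB m (b :: p)
      = b :: gamePath (fun q => σA (b :: q)) (fun q => σB (b :: q)) m p := by
  induction m generalizing p with
  | zero => simp [gamePath]
  | succ m ih => rw [gamePath, gamePath, List.cons_append, ih]

theorem leafVal_step (m : ℕ) (x : Fin (2^(m+1)) → Bool) (σA σB : List Bool → Bool) (b : Bool)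
    (hb : (if (m+1) % 2 = 0 then σA [] else σB []) = b) :
    leafVal (m+1) x (gamePath σA σB (m+1) [])
      = leafVal m (halfInput m b x)
          (gamePath (fun q => σA (b :: q)) (fun q => σB (b :: q)) m []) := by
  rw [gamePath, hb, List.nil_append, gamePath_cons, leafVal_cons]
  simp [gamePath_length]

/-- Prepend a root choice `b` to a family of strategies for the two subtrees. -/
def glue (b : Bool) (f : Bool → List Bool → Bool) : List Bool → Bool
  | [] => b
  | c :: q => f c q

theorem winning_own (Z : Bool) (m : ℕ) (x : Fin (2^(m+1)) → Bool) (σ : List Bool → Bool)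
    (hZ : decide ((m+1) % 2 = 0) = Z)
    (hw : winning Z m (halfInput m (σ []) x) (fun q => σ (σ [] :: q))) :
    winning Z (m+1) x σ := by
  intro τ
  rw [leafVal_step m x _ _ (σ [])]
  · have := hw (fun q => τ (σ [] :: q))
    cases Z <;> simpa using this
  · subst hZ
    by_cases h : (m+1) % 2 = 0 <;> simp [h]

theorem winning_opp (Z : Bool) (m : ℕ) (x : Fin (2^(m+1)) → Bool) (σ : List Bool → Bool)
    (hZ : decide ((m+1) % 2 = 0) ≠ Z) :
    winning Z (m+1) x σ ↔ ∀ b, winning Z m (halfInput m b x) (fun q => σ (b :: q)) := by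
  constructor
  · intro hw b τ
    have := hw (glue b (fun _ => τ))
    rw [leafVal_step m x _ _ b] at this
    · cases Z <;> simpa [glue] using this
    · by_cases h : (m+1) % 2 = 0 <;> cases Z <;> simp_all [glue]
  · intro hw τ
    rw [leafVal_step m x _ _ (τ [])]
    · have := hw (τ []) (fun q => τ (τ [] :: q))
      cases Z <;> simpa using this
    · by_cases h : (m+1) % 2 = 0 <;> cases Z <;> simp_all

theorem exists_winning (Z : Bool) (m : ℕ) (x : Fin (2^m) → Bool) (h : nand m x = Z) :
    ∃ σ, winning Z m x σ := by
  induction m with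
  | zero =>
    refine ⟨fun _ => false, fun τ => ?_⟩
    simpa [gamePath, leafVal, leafIdx, nand] using h
  | succ m ih =>
    by_cases hZ : decide ((m+1) % 2 = 0) = Z
    · have : ∃ b, nand m (halfInput m b x) = Z := by
        rw [nand] at h
        by_cases hm : (m+1) % 2 = 0
        · simp only [hm, if_true, decide_true] at h hZ
          subst hZ
          rcases (Bool.or_eq_true _ _).mp h with h | h <;> exact ⟨_, h⟩
        · simp only [hm, if_false, decide_false] at h hZ
          subst hZ
          rcases (Bool.and_eq_false_iff).mp h with h | h <;> exact ⟨_, h⟩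
      obtain ⟨b, hb⟩ := this
      obtain ⟨σ, hσ⟩ := ih _ hb
      exact ⟨glue b (fun _ => σ), winning_own Z m x _ hZ hσ⟩
    · have : ∀ b, nand m (halfInput m b x) = Z := by
        rw [nand] at h
        by_cases hm : (m+1) % 2 = 0
        · intro b
          cases b <;> cases Z <;> simp_all
        · intro b
          cases b <;> cases Z <;> simp_all
      choose f hf using fun b => ih _ (this b)
      exact ⟨glue false f, (winning_opp Z m x _ hZ).mpr hf⟩

theorem ratio_ne_top (a b : ℝ≥0∞) : max a b / ((a + b) / 2) ≠ ⊤ := by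
  by_cases h0 : max a b = 0
  · rw [h0]; simp
  by_cases ht : a + b = ⊤
  · rw [ht, ENNReal.top_div_of_ne_top (by simp)]; simp
  · apply ENNReal.div_ne_top
    · rcases max_cases a b with h | h <;> simp_all
    · intro h
      rw [ENNReal.div_eq_zero_iff] at h
      simp_all

theorem crit_ne_top (m : ℕ) (y : Fin (2^m) → Bool) : crit m y ≠ ⊤ := by
  match m, y with
  | 0, y => simp [crit]
  | 1, y => rw [crit]; split_ifs <;> simp
  | m+2, y =>
    rw [crit]
    split_ifs
    · simp
    · simp
    · exact ratio_ne_top _ _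

theorem pathProd_ne_top (Z : Bool) (σ : List Bool → Bool) (m : ℕ) (y : Fin (2^m) → Bool) :
    pathProd Z σ m y ≠ ⊤ := by
  induction m generalizing σ with
  | zero => simp [pathProd]
  | succ m ih =>
    rw [pathProd]
    split_ifs
    · exact ENNReal.mul_ne_top (crit_ne_top _ _) (ih _ _)
    · exact ENNReal.div_ne_top (ENNReal.add_ne_top.mpr ⟨ih _ _, ih _ _⟩) (by simp)

theorem CZ_ne_top (Z : Bool) (m : ℕ) (y : Fin (2^m) → Bool) (h : nand m y = Z) :
    CZ Z m y ≠ ⊤ := by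
  obtain ⟨σ, hσ⟩ := exists_winning Z m y h
  rw [CZ]
  exact ne_top_of_le_ne_top (pathProd_ne_top Z σ m y) (iInf₂_le σ hσ)

theorem CZ_opp (Z : Bool) (m : ℕ) (x : Fin (2^(m+1)) → Bool)
    (hZ : decide ((m+1) % 2 = 0) ≠ Z) :
    CZ Z (m+1) x = (CZ Z m (halfInput m false x) + CZ Z m (halfInput m true x)) / 2 := by
  apply le_antisymm
  · rw [ENNReal.le_div_iff_mul_le (by simp) (by simp)]
    rw [CZ, CZ, CZ]
    simp only [ENNReal.iInf_add, ENNReal.add_iInf]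
    refine le_iInf₂ fun σ₁ h₁ => le_iInf₂ fun σ₂ h₂ => ?_
    rw [← ENNReal.le_div_iff_mul_le (by simp) (by simp)]
    refine (iInf₂_le (glue false (fun b => if b then σ₁ else σ₂)) ?_).trans ?_
    · refine (winning_opp Z m x _ hZ).mpr fun b => ?_
      cases b <;> simpa [glue] using ‹_›
    · rw [pathProd, if_neg hZ]
      simp [glue]
  · rw [CZ.eq_1 Z (m+1)]
    refine le_iInf₂ fun σ hσ => ?_
    have hw := (winning_opp Z m x σ hZ).mp hσ
    rw [pathProd, if_neg hZ, CZ, CZ]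
    gcongr
    · exact iInf₂_le _ (hw false)
    · exact iInf₂_le _ (hw true)

/-- For odd depth `ℓ = 2d+1` and A-winnable `x` with halves `x^0`,
`x^1`: `C_A(x) = (1/2)(C_A(x^0) + C_A(x^1))`, and in particular both are finite. -/
theorem CA_odd_depth (d : ℕ) (x : Fin (2^(2*d+1)) → Bool)
    (h : nand (2*d+1) x = true) :
    CZ true (2*d+1) x
      = (CZ true (2*d) (halfInput (2*d) false x) + CZ true (2*d) (halfInput (2*d) true x)) / 2 ∧
    CZ true (2*d) (halfInput (2*d) false x) ≠ ⊤ ∧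
    CZ true (2*d) (halfInput (2*d) true x) ≠ ⊤ := by
  have hb : nand (2*d) (halfInput (2*d) false x) = true ∧
      nand (2*d) (halfInput (2*d) true x) = true := by
    rw [nand, if_neg (by omega)] at h
    simpa using h
  exact ⟨CZ_opp true (2*d) x (by simp), CZ_ne_top _ _ _ hb.1, CZ_ne_top _ _ _ hb.2⟩

end NandTree
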